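/- For G = ES_2(p,n), the automorphism group has cardinality |Aut(G)| = p^{n²+2n}(p−1)·∏_{j=1}^{n−1}(p^{2j}−1). -/

import Mathlib

open Matrix

/-- The additive embedding `ℤ/pℤ → ℤ/p²ℤ`, `a ↦ p·a`. -/
def emb (p : ℕ) (a : ZMod p) : ZMod (p ^ 2) := (p : ZMod (p ^ 2)) * (a.val : ZMod (p ^ 2))

/-- Reduction modulo `p`, `ℤ/p²ℤ → ℤ/pℤ`. -/
def red (p : ℕ) : ZMod (p ^ 2) →+* ZMod p :=
  ZMod.castHom (dvd_pow_self p (by norm_num)) (ZMod p)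

section EmbLemmas

variable {p : ℕ} [NeZero p]

theorem emb_sq_zero : (p : ZMod (p ^ 2)) * (p : ZMod (p ^ 2)) = 0 := by
  have h : ((p ^ 2 : ℕ) : ZMod (p ^ 2)) = 0 := ZMod.natCast_self _
  push_cast at h
  linear_combination h

theorem emb_mod (k : ℕ) :
    (p : ZMod (p ^ 2)) * ((k % p : ℕ) : ZMod (p ^ 2)) = (p : ZMod (p ^ 2)) * (k : ℕ) := by
  conv_rhs => rw [← Nat.div_add_mod k p]
  push_cast
  linear_combination (-((k / p : ℕ) : ZMod (p ^ 2))) * emb_sq_zero (p := p)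

theorem emb_add (a b : ZMod p) : emb p (a + b) = emb p a + emb p b := by
  unfold emb
  rw [ZMod.val_add, emb_mod]
  push_cast
  ring

theorem emb_zero : emb p (0 : ZMod p) = 0 := by
  simp [emb]

theorem emb_neg (a : ZMod p) : emb p (-a) = -emb p a := by
  have h := emb_add (p := p) (-a) a
  rw [neg_add_cancel, emb_zero] at h
  exact eq_neg_of_add_eq_zero_left h.symm

theorem emb_sub (a b : ZMod p) : emb p (a - b) = emb p a - emb p b := by
  rw [sub_eq_add_neg, emb_add, emb_neg]; ring

theorem emb_mul_emb (a b : ZMod p) : emb p a * emb p b = 0 := by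
  unfold emb
  calc (p : ZMod (p ^ 2)) * (a.val : ZMod (p ^ 2)) * ((p : ZMod (p ^ 2)) * (b.val : ZMod (p ^ 2)))
      = ((p : ZMod (p^2)) * (p : ZMod (p^2))) * ((a.val : ZMod (p ^ 2)) * (b.val : ZMod (p ^ 2))) := by ring
    _ = 0 := by rw [emb_sq_zero]; ring

theorem red_emb (a : ZMod p) : red p (emb p a) = 0 := by
  unfold emb
  rw [_root_.map_mul, map_natCast, ZMod.natCast_self]
  ring

end EmbLemmas

/-- The extra-special `p`-group of exponent `p²` and order `p^(2(m+1)+1)`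
(so `n = m + 1` in the paper's notation). -/
@[ext]
structure ES2 (p m : ℕ) : Type where
  u1 : ZMod (p ^ 2)
  u : Fin m → ZMod p
  w1 : ZMod p
  w : Fin m → ZMod p

namespace ES2

variable {p m : ℕ}

instance : Mul (ES2 p m) :=
  ⟨fun x y => ⟨x.u1 + y.u1 + emb p y.w1 * x.u1 + emb p (x.u ⬝ᵥ y.w),
    x.u + y.u, x.w1 + y.w1, x.w + y.w⟩⟩

@[simp] theorem mul_u1 (x y : ES2 p m) :
    (x * y).u1 = x.u1 + y.u1 + emb p y.w1 * x.u1 + emb p (x.u ⬝ᵥ y.w) := rfl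
@[simp] theorem mul_u (x y : ES2 p m) : (x * y).u = x.u + y.u := rfl
@[simp] theorem mul_w1 (x y : ES2 p m) : (x * y).w1 = x.w1 + y.w1 := rfl
@[simp] theorem mul_w (x y : ES2 p m) : (x * y).w = x.w + y.w := rfl

instance : One (ES2 p m) := ⟨⟨0, 0, 0, 0⟩⟩

@[simp] theorem one_u1 : (1 : ES2 p m).u1 = 0 := rfl
@[simp] theorem one_u : (1 : ES2 p m).u = 0 := rfl
@[simp] theorem one_w1 : (1 : ES2 p m).w1 = 0 := rfl
@[simp] theorem one_w : (1 : ES2 p m).w = 0 := rfl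

instance : Inv (ES2 p m) :=
  ⟨fun x => ⟨(1 - emb p x.w1) * (-x.u1 + emb p (x.u ⬝ᵥ x.w)), -x.u, -x.w1, -x.w⟩⟩

@[simp] theorem inv_u1 (x : ES2 p m) :
    (x⁻¹).u1 = (1 - emb p x.w1) * (-x.u1 + emb p (x.u ⬝ᵥ x.w)) := rfl
@[simp] theorem inv_u (x : ES2 p m) : (x⁻¹).u = -x.u := rfl
@[simp] theorem inv_w1 (x : ES2 p m) : (x⁻¹).w1 = -x.w1 := rfl
@[simp] theorem inv_w (x : ES2 p m) : (x⁻¹).w = -x.w := rfl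

instance [NeZero p] : Group (ES2 p m) :=
  Group.ofLeftAxioms
    (fun a b c => by
      ext
      · simp only [mul_u1, mul_u, mul_w1, mul_w, add_dotProduct, dotProduct_add, emb_add]
        linear_combination a.u1 * emb_mul_emb c.w1 b.w1 +
          emb_mul_emb c.w1 (a.u ⬝ᵥ b.w)
      · simp [add_assoc]
      · simp [add_assoc]
      · simp [add_assoc])
    (fun a => by
      ext <;> simp [emb_zero])
    (fun a => by
      ext
      · simp only [mul_u1, inv_u1, inv_u, inv_w1, inv_w, one_u1, neg_dotProduct, emb_neg]
        linear_combination (a.u1 - emb p (a.u ⬝ᵥ a.w)) * emb_mul_emb a.w1 a.w1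
      · simp
      · simp
      · simp)

end ES2

section Symp

variable {p : ℕ} [Fact p.Prime]

/-- symplectic tuples -/
def Symp {W : Type} [AddCommGroup W] [Module (ZMod p) W]
    (ω : W →ₗ[ZMod p] W →ₗ[ZMod p] ZMod p) (m : ℕ) (l : ZMod p) : Type :=
  {ab : (Fin m → W) × (Fin m → W) // (∀ i j, ω (ab.1 i) (ab.1 j) = 0) ∧
    (∀ i j, ω (ab.2 i) (ab.2 j) = 0) ∧ ∀ i j, ω (ab.1 i) (ab.2 j) = if i = j then l else 0}

/-- complement of a pair -/
def cpl {W : Type} [AddCommGroup W] [Module (ZMod p) W]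
    (ω : W →ₗ[ZMod p] W →ₗ[ZMod p] ZMod p) (q : W × W) : Submodule (ZMod p) W :=
  LinearMap.ker (ω q.1) ⊓ LinearMap.ker (ω q.2)

theorem mem_cpl {W : Type} [AddCommGroup W] [Module (ZMod p) W]
    (ω : W →ₗ[ZMod p] W →ₗ[ZMod p] ZMod p) (q : W × W) (v : W) :
    v ∈ cpl ω q ↔ ω q.1 v = 0 ∧ ω q.2 v = 0 := by
  simp [cpl]

/-- restricted form -/
def rst {W : Type} [AddCommGroup W] [Module (ZMod p) W]
    (ω : W →ₗ[ZMod p] W →ₗ[ZMod p] ZMod p) (U : Submodule (ZMod p) W) :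
    U →ₗ[ZMod p] U →ₗ[ZMod p] ZMod p := ω.compl₁₂ U.subtype U.subtype

theorem rst_apply {W : Type} [AddCommGroup W] [Module (ZMod p) W]
    (ω : W →ₗ[ZMod p] W →ₗ[ZMod p] ZMod p) (U : Submodule (ZMod p) W) (x y : U) :
    rst ω U x y = ω x y := rfl

theorem sk {W : Type} [AddCommGroup W] [Module (ZMod p) W]
    {ω : W →ₗ[ZMod p] W →ₗ[ZMod p] ZMod p} (halt : ∀ v, ω v v = 0) (v w : W) :
    ω v w = - ω w v := by
  have h := halt (v + w)
  simp only [map_add, LinearMap.add_apply, halt] at h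
  linear_combination h

/-- peel one pair -/
def sympSucc {W : Type} [AddCommGroup W] [Module (ZMod p) W]
    (ω : W →ₗ[ZMod p] W →ₗ[ZMod p] ZMod p) (halt : ∀ v, ω v v = 0) (m : ℕ) (l : ZMod p) :
    Symp ω (m + 1) l ≃ Σ q : {q : W × W // ω q.1 q.2 = l}, Symp (rst ω (cpl ω q.1)) m l where
  toFun x := ⟨⟨(x.1.1 0, x.1.2 0), by simpa using x.2.2.2 0 0⟩,
    ⟨(fun i => ⟨x.1.1 i.succ, by
        rw [mem_cpl]
        refine ⟨x.2.1 _ _, ?_⟩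
        rw [sk halt]
        have := x.2.2.2 i.succ 0
        simp only [Fin.succ_ne_zero, if_false] at this
        simp [this]⟩,
      fun i => ⟨x.1.2 i.succ, by
        rw [mem_cpl]
        refine ⟨?_, x.2.2.1 _ _⟩
        have := x.2.2.2 0 i.succ
        simpa [(Fin.succ_ne_zero i).symm] using this⟩),
      by
        refine ⟨fun i j => x.2.1 _ _, fun i j => x.2.2.1 _ _, fun i j => ?_⟩
        have := x.2.2.2 i.succ j.succ
        simpa [rst_apply] using this⟩⟩
  invFun y := ⟨(Fin.cons y.1.1.1 (fun i => (y.2.1.1 i : W)),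
      Fin.cons y.1.1.2 (fun i => (y.2.1.2 i : W))), by
    obtain ⟨⟨⟨a, b⟩, hab⟩, ⟨⟨u, w⟩, h1, h2, h3⟩⟩ := y
    have hu := fun i => (mem_cpl _ _ _).1 (u i).2
    have hw := fun i => (mem_cpl _ _ _).1 (w i).2
    simp only [rst_apply] at h1 h2 h3 hu hw hab
    refine ⟨fun i j => ?_, fun i j => ?_, fun i j => ?_⟩
    · refine Fin.cases ?_ (fun i => ?_) i <;> refine Fin.cases ?_ (fun j => ?_) j
      · simp [halt]
      · simp [hu]
      · simp only [Fin.cons_zero, Fin.cons_succ]; rw [sk halt]; simp [hu]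
      · simp [h1]
    · refine Fin.cases ?_ (fun i => ?_) i <;> refine Fin.cases ?_ (fun j => ?_) j
      · simp [halt]
      · simp [hw]
      · simp only [Fin.cons_zero, Fin.cons_succ]; rw [sk halt]; simp [hw]
      · simp [h2]
    · refine Fin.cases ?_ (fun i => ?_) i <;> refine Fin.cases ?_ (fun j => ?_) j
      · simp [hab]
      · simp [hw, (Fin.succ_ne_zero j).symm]
      · simp only [Fin.cons_zero, Fin.cons_succ]; rw [sk halt]; simp [hu]
      · simp [h3]⟩
  left_inv x := by
    apply Subtype.ext
    refine Prod.ext ?_ ?_ <;> funext i <;> refine Fin.cases ?_ (fun i => ?_) i <;> rfl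
  right_inv y := by
    rfl

theorem exists_pair {W : Type} [AddCommGroup W] [Module (ZMod p) W]
    {ω : W →ₗ[ZMod p] W →ₗ[ZMod p] ZMod p} (hnd : ∀ v, (∀ w, ω v w = 0) → v = 0)
    (a : W) (ha : a ≠ 0) : ∃ b, ω a b = 1 := by
  by_contra! h
  apply ha
  apply hnd
  intro w
  by_contra hw
  apply h ((ω a w)⁻¹ • w)
  simp [hw]

theorem card_fib {W : Type} [AddCommGroup W] [Module (ZMod p) W]
    (ω : W →ₗ[ZMod p] W →ₗ[ZMod p] ZMod p) (hnd : ∀ v, (∀ w, ω v w = 0) → v = 0)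
    (a : W) (ha : a ≠ 0) (l : ZMod p) : Nat.card W = Nat.card {b // ω a b = l} * p := by
  obtain ⟨b, hb⟩ := exists_pair hnd a ha
  have e : W ≃ {b // ω a b = l} × ZMod p :=
    { toFun := fun v => (⟨v + (l - ω a v) • b, by simp [hb]⟩, ω a v)
      invFun := fun x => x.1.1 + (x.2 - l) • b
      left_inv := fun v => by simp only; module
      right_inv := fun x => by
        obtain ⟨⟨v, hv⟩, t⟩ := x
        ext
        · simp only [map_add, map_smul, hb, hv, smul_eq_mul]; module
        · simp [hb, hv] }
  rw [Nat.card_congr e, Nat.card_prod, Nat.card_zmod]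

theorem card_cpl {W : Type} [AddCommGroup W] [Module (ZMod p) W]
    (ω : W →ₗ[ZMod p] W →ₗ[ZMod p] ZMod p) (halt : ∀ v, ω v v = 0) (q : W × W)
    (l : ZMod p) (hl : l ≠ 0) (hq : ω q.1 q.2 = l) :
    Nat.card W = Nat.card (cpl ω q) * p * p := by
  obtain ⟨a, b⟩ := q
  simp only at hq
  have hba : ω b a = -l := by rw [sk halt, hq]
  have e : W ≃ (cpl ω (a, b) × ZMod p) × ZMod p :=
    { toFun := fun v => ((⟨v - (l⁻¹ * ω a v) • b + (l⁻¹ * ω b v) • a, by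
          rw [mem_cpl]; simp [hq, hba, halt]; constructor <;> field_simp <;> ring⟩, ω a v), ω b v)
      invFun := fun x => x.1.1 + (l⁻¹ * x.1.2) • b - (l⁻¹ * x.2) • a
      left_inv := fun v => by simp only; module
      right_inv := fun x => by
        obtain ⟨⟨⟨v, hv⟩, s⟩, t⟩ := x
        rw [mem_cpl] at hv
        simp only at hv
        have h1 : ω a (v + (l⁻¹ * s) • b - (l⁻¹ * t) • a) = s := by
          simp [hq, hv, halt]; field_simp
        have h2 : ω b (v + (l⁻¹ * s) • b - (l⁻¹ * t) • a) = t := by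
          simp [hba, hv, halt]; field_simp
        ext
        · simp only [h1, h2]; module
        · simp only [h1]
        · simp only [h2] }
  rw [Nat.card_congr e, Nat.card_prod, Nat.card_prod, Nat.card_zmod]

theorem nd_cpl {W : Type} [AddCommGroup W] [Module (ZMod p) W]
    (ω : W →ₗ[ZMod p] W →ₗ[ZMod p] ZMod p) (halt : ∀ v, ω v v = 0)
    (hnd : ∀ v, (∀ w, ω v w = 0) → v = 0) (q : W × W)
    (l : ZMod p) (hl : l ≠ 0) (hq : ω q.1 q.2 = l) (v : cpl ω q)
    (hv : ∀ w, rst ω (cpl ω q) v w = 0) : v = 0 := by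
  obtain ⟨a, b⟩ := q
  simp only at hq
  have hba : ω b a = -l := by rw [sk halt, hq]
  obtain ⟨v, hm⟩ := v
  have hm' := (mem_cpl _ _ _).1 hm
  simp only at hm'
  apply Subtype.ext
  apply hnd
  intro w
  have h := hv ⟨w - (l⁻¹ * ω a w) • b + (l⁻¹ * ω b w) • a, by
          rw [mem_cpl]; simp [hq, hba, halt]; constructor <;> field_simp <;> ring⟩
  rw [rst_apply] at h
  simp only [map_add, map_sub, map_smul, sk halt v a, sk halt v b, hm'] at h
  simpa using h

theorem card_pairs {W : Type} [AddCommGroup W] [Module (ZMod p) W] [Finite W]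
    (ω : W →ₗ[ZMod p] W →ₗ[ZMod p] ZMod p) (hnd : ∀ v, (∀ w, ω v w = 0) → v = 0)
    (l : ZMod p) (hl : l ≠ 0) (k : ℕ) (hk : Nat.card W = p ^ (k + 1)) :
    Nat.card {q : W × W // ω q.1 q.2 = l} = (p ^ (k + 1) - 1) * p ^ k := by
  have hp : 0 < p := (Fact.out : p.Prime).pos
  have e : {q : W × W // ω q.1 q.2 = l} ≃ Σ a : {a : W // a ≠ 0}, {b // ω a.1 b = l} :=
    { toFun := fun q => ⟨⟨q.1.1, fun h => hl (by rw [← q.2, h]; simp)⟩, ⟨q.1.2, q.2⟩⟩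
      invFun := fun x => ⟨(x.1.1, x.2.1), x.2.2⟩
      left_inv := fun _ => rfl
      right_inv := fun _ => rfl }
  have : Fintype W := Fintype.ofFinite W
  classical
  rw [Nat.card_congr e, Nat.card_sigma]
  have h : ∀ a : {a : W // a ≠ 0}, Nat.card {b // ω a.1 b = l} = p ^ k := fun a => by
    have := card_fib ω hnd a.1 a.2 l
    rw [hk, pow_succ] at this
    exact (Nat.eq_of_mul_eq_mul_right hp this).symm
  simp only [h, Finset.sum_const, smul_eq_mul, Finset.card_univ]
  congr 1
  rw [← hk, Nat.card_eq_fintype_card, Fintype.card_subtype_compl]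
  simp

theorem card_symp (m : ℕ) : ∀ (W : Type) [AddCommGroup W] [Module (ZMod p) W] [Finite W]
    (ω : W →ₗ[ZMod p] W →ₗ[ZMod p] ZMod p) (_ : ∀ v, ω v v = 0)
    (_ : ∀ v, (∀ w, ω v w = 0) → v = 0) (l : ZMod p) (_ : l ≠ 0)
    (_ : Nat.card W = p ^ (2 * m)),
    Nat.card (Symp ω m l) = p ^ (m ^ 2) * ∏ j ∈ Finset.Icc 1 m, (p ^ (2 * j) - 1) := by
  have hp : 0 < p := (Fact.out : p.Prime).pos
  induction m with
  | zero =>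
    intro W _ _ _ ω _ _ l _ _
    have : Unique (Symp ω 0 l) :=
      { default := ⟨(Fin.elim0, Fin.elim0), fun i => i.elim0, fun i => i.elim0, fun i => i.elim0⟩
        uniq := fun x => Subtype.ext (Subsingleton.elim _ _) }
    simp
  | succ m ih =>
    intro W _ _ _ ω halt hnd l hl hW
    have : Fintype {q : W × W // ω q.1 q.2 = l} := Fintype.ofFinite _
    have : ∀ q : {q : W × W // ω q.1 q.2 = l}, Finite (Symp (rst ω (cpl ω q.1)) m l) :=
      fun q => by unfold Symp; infer_instance
    rw [Nat.card_congr (sympSucc ω halt m l), Nat.card_sigma]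
    have h : ∀ q : {q : W × W // ω q.1 q.2 = l}, Nat.card (Symp (rst ω (cpl ω q.1)) m l)
        = p ^ (m ^ 2) * ∏ j ∈ Finset.Icc 1 m, (p ^ (2 * j) - 1) := fun q => by
      apply ih
      · intro v; rw [rst_apply]; exact halt _
      · exact nd_cpl ω halt hnd q.1 l hl q.2
      · exact hl
      · have := card_cpl ω halt q.1 l hl q.2
        rw [hW, show 2 * (m + 1) = 2 * m + 1 + 1 by ring, pow_succ, pow_succ] at this
        exact (Nat.eq_of_mul_eq_mul_right hp (Nat.eq_of_mul_eq_mul_right hp this)).symm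
    simp only [h, Finset.sum_const, smul_eq_mul, Finset.card_univ]
    rw [← Nat.card_eq_fintype_card,
      card_pairs ω hnd l hl (2 * m + 1) (by rw [hW]; ring_nf), Finset.prod_Icc_succ_top (by omega)]
    rw [show 2 * (m + 1) = 2 * m + 1 + 1 by ring, show (m + 1) ^ 2 = m ^ 2 + (2 * m + 1) by ring,
      pow_add p (m ^ 2)]
    ring

end Symp
section EmbMore

variable {p : ℕ} [Fact p.Prime]

theorem emb_natCast (k : ℕ) : emb p (k : ZMod p) = (p : ZMod (p ^ 2)) * k := by
  unfold emb
  rw [ZMod.val_natCast, emb_mod]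

theorem emb_mul_red (a : ZMod p) (s : ZMod (p ^ 2)) : emb p a * s = emb p (a * red p s) := by
  have : NeZero (p ^ 2) := ⟨pow_ne_zero 2 (Fact.out : p.Prime).ne_zero⟩
  conv_lhs => rw [← ZMod.natCast_zmod_val a, ← ZMod.natCast_zmod_val s]
  conv_rhs => rw [← ZMod.natCast_zmod_val a, ← ZMod.natCast_zmod_val s]
  rw [map_natCast, ← Nat.cast_mul, emb_natCast, emb_natCast]
  push_cast
  ring

theorem emb_eq_zero {a : ZMod p} (h : emb p a = 0) : a = 0 := by
  have hp : 0 < p := (Fact.out : p.Prime).pos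
  unfold emb at h
  rw [← Nat.cast_mul, ZMod.natCast_eq_zero_iff, sq] at h
  have h2 := Nat.dvd_of_mul_dvd_mul_left hp h
  rw [← ZMod.natCast_zmod_val a, ZMod.natCast_eq_zero_iff]
  exact h2

theorem emb_inj {a b : ZMod p} (h : emb p a = emb p b) : a = b := by
  have : emb p (a - b) = 0 := by rw [emb_sub, h, sub_self]
  exact sub_eq_zero.1 (emb_eq_zero this)

theorem exists_emb {s : ZMod (p ^ 2)} (h : red p s = 0) : ∃ a, s = emb p a := by
  have : NeZero (p ^ 2) := ⟨pow_ne_zero 2 (Fact.out : p.Prime).ne_zero⟩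
  rw [← ZMod.natCast_zmod_val s, map_natCast, ZMod.natCast_eq_zero_iff] at h
  obtain ⟨k, hk⟩ := h
  refine ⟨k, ?_⟩
  rw [emb_natCast, ← ZMod.natCast_zmod_val s, hk]
  push_cast
  rfl

theorem isUnit_of_red {s : ZMod (p ^ 2)} (h : red p s ≠ 0) : IsUnit s := by
  have : NeZero (p ^ 2) := ⟨pow_ne_zero 2 (Fact.out : p.Prime).ne_zero⟩
  rw [← ZMod.natCast_zmod_val s, map_natCast, Ne, ZMod.natCast_eq_zero_iff] at h
  rw [← ZMod.natCast_zmod_val s, ZMod.isUnit_iff_coprime]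
  apply Nat.Coprime.pow_right
  exact (((Fact.out : p.Prime).coprime_iff_not_dvd).2 h).symm

theorem p_mul_eq_emb (s : ZMod (p ^ 2)) : (p : ZMod (p ^ 2)) * s = emb p (red p s) := by
  have := emb_mul_red 1 s
  rw [one_mul] at this
  rw [← this]
  have h1 := emb_natCast (p := p) 1
  simp only [Nat.cast_one, mul_one] at h1
  rw [h1]

end EmbMore

section Lie

variable {p : ℕ} [Fact p.Prime] {V : Type} [AddCommGroup V] [Module (ZMod p) V]

/-- The commutator form. -/
def Bf (ω : V →ₗ[ZMod p] V →ₗ[ZMod p] ZMod p) (x y : ZMod (p ^ 2) × ZMod p × V) : ZMod p :=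
  red p x.1 * y.2.1 - red p y.1 * x.2.1 + ω x.2.2 y.2.2

/-- central embedding -/
def io (V : Type) [AddCommGroup V] (a : ZMod p) : ZMod (p ^ 2) × ZMod p × V := (emb p a, 0, 0)

/-- The Baer product. -/
def bmul (ω : V →ₗ[ZMod p] V →ₗ[ZMod p] ZMod p) (c : ZMod p)
    (x y : ZMod (p ^ 2) × ZMod p × V) : ZMod (p ^ 2) × ZMod p × V :=
  x + y + io V (c * Bf ω x y)

variable (ω : V →ₗ[ZMod p] V →ₗ[ZMod p] ZMod p)

theorem io_add (a b : ZMod p) : io V (a + b) = io V a + io V b := by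
  simp [io, emb_add]

theorem io_inj {a b : ZMod p} (h : io V a = io V b) : a = b :=
  emb_inj (congrArg Prod.fst h)

theorem io_zero : io V (0 : ZMod p) = 0 := by
  simp only [io, emb_zero]; rfl

theorem Bf_add_left (x y z) : Bf ω (x + y) z = Bf ω x z + Bf ω y z := by
  simp only [Bf, Prod.fst_add, Prod.snd_add, map_add, LinearMap.add_apply]; ring

theorem Bf_add_right (x y z) : Bf ω x (y + z) = Bf ω x y + Bf ω x z := by
  simp only [Bf, Prod.fst_add, Prod.snd_add, map_add]; ring

theorem Bf_io_right (x) (a : ZMod p) : Bf ω x (io V a) = 0 := by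
  simp [Bf, io, red_emb]

theorem Bf_io_left (x) (a : ZMod p) : Bf ω (io V a) x = 0 := by
  simp [Bf, io, red_emb]

theorem Bf_nsmul_right (k : ℕ) (x y) : Bf ω x (k • y) = k * Bf ω x y := by
  induction k with
  | zero => simp [Bf]
  | succ k ih => rw [succ_nsmul, Bf_add_right, ih]; push_cast; ring

theorem Bf_skew (halt : ∀ v, ω v v = 0) (x y) : Bf ω x y = - Bf ω y x := by
  simp only [Bf]; rw [sk halt x.2.2]; ring

theorem Bf_self (halt : ∀ v, ω v v = 0) (x) : Bf ω x x = 0 := by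
  simp only [Bf, halt]; ring

variable {ω} in
/-- Multiplicative injections are additive and preserve the bracket. -/
theorem lie_of_bmul (halt : ∀ v, ω v v = 0) (c : ZMod p) (hc : 2 * c = 1)
    (φ : ZMod (p ^ 2) × ZMod p × V → ZMod (p ^ 2) × ZMod p × V)
    (hφ : ∀ x y, φ (bmul ω c x y) = bmul ω c (φ x) (φ y)) :
    (∀ x y, φ (x + y) = φ x + φ y) ∧ ∀ x y, φ (io V (Bf ω x y)) = io V (Bf ω (φ x) (φ y)) := by
  -- commuting elements
  have hcom : ∀ x y, Bf ω x y = 0 → Bf ω (φ x) (φ y) = 0 := by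
    intro x y h
    have h' : Bf ω y x = 0 := by rw [Bf_skew ω halt, h, neg_zero]
    have e : bmul ω c x y = bmul ω c y x := by simp only [bmul, h, h', add_comm]
    have e2 := congrArg φ e
    rw [hφ, hφ, bmul, bmul, add_comm (φ y)] at e2
    have e3 := io_inj (add_left_cancel e2)
    rw [Bf_skew ω halt (φ y)] at e3
    linear_combination e3 - Bf ω (φ x) (φ y) * hc
  have hadd : ∀ x y, Bf ω x y = 0 → φ (x + y) = φ x + φ y := by
    intro x y h
    have := hφ x y
    simpa [bmul, h, hcom x y h, io_zero] using this
  have h0 : φ 0 = 0 := by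
    have := hadd 0 0 (Bf_self ω halt 0)
    simpa using this
  have hns : ∀ (k : ℕ) x, φ (k • x) = k • φ x := by
    intro k x
    induction k with
    | zero => simp [h0]
    | succ k ih =>
      rw [succ_nsmul, hadd, ih, succ_nsmul]
      rw [Bf_skew ω halt, Bf_nsmul_right, Bf_self ω halt]; simp
  have hbr : ∀ x y, φ (io V (Bf ω x y)) = io V (Bf ω (φ x) (φ y)) := by
    intro x y
    have e : bmul ω c x y = bmul ω c y x + io V (Bf ω x y) := by
      simp only [bmul]
      rw [add_assoc (y + x), ← io_add, add_comm y x, Bf_skew ω halt y x]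
      congr 2
      linear_combination Bf ω x y * hc
    have e2 := congrArg φ e
    rw [hadd _ _ (Bf_io_right ω _ _), hφ, hφ] at e2
    have e' : bmul ω c (φ x) (φ y) = bmul ω c (φ y) (φ x) + io V (Bf ω (φ x) (φ y)) := by
      simp only [bmul]
      rw [add_assoc (φ y + φ x), ← io_add, add_comm (φ y) (φ x), Bf_skew ω halt (φ y) (φ x)]
      congr 2
      linear_combination Bf ω (φ x) (φ y) * hc
    rw [e'] at e2
    exact (add_left_cancel e2).symm
  refine ⟨fun x y => ?_, hbr⟩
  have e1 := hφ x y
  have e2 : c * Bf ω x y = Bf ω x (c.val • y) := by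
    rw [Bf_nsmul_right, ZMod.natCast_zmod_val]
  have e3 : c * Bf ω (φ x) (φ y) = Bf ω (φ x) (φ (c.val • y)) := by
    rw [hns, Bf_nsmul_right, ZMod.natCast_zmod_val]
  rw [bmul, bmul, hadd _ _ (Bf_io_right ω _ _), e2, e3, hbr] at e1
  exact add_right_cancel e1

/-- Similitudes with multiplier `l`. -/
def Sim (l : ZMod p) : Type :=
  {A : V →ₗ[ZMod p] V // ∀ v w, ω (A v) (A w) = l * ω v w}

/-- explicit automorphism -/
def mk (σ : ZMod (p ^ 2)) (τ z : ZMod p) (v0 : V) (ζ : V →ₗ[ZMod p] ZMod p) (A : V →ₗ[ZMod p] V)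
    (x : ZMod (p ^ 2) × ZMod p × V) : ZMod (p ^ 2) × ZMod p × V :=
  (σ * x.1 + emb p (z * x.2.1 + ζ x.2.2),
    x.2.1 + τ * red p x.1 - (red p σ)⁻¹ * ω v0 (A x.2.2), A x.2.2 + red p x.1 • v0)

theorem mk_add (σ : ZMod (p ^ 2)) (τ z : ZMod p) (v0 : V) (ζ : V →ₗ[ZMod p] ZMod p)
    (A : V →ₗ[ZMod p] V) (x y) :
    mk ω σ τ z v0 ζ A (x + y) = mk ω σ τ z v0 ζ A x + mk ω σ τ z v0 ζ A y := by
  simp only [mk, Prod.mk_add_mk, Prod.fst_add, Prod.snd_add, map_add, mul_add, emb_add, add_smul]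
  refine Prod.ext ?_ (Prod.ext ?_ ?_) <;> simp only
  · ring
  · ring
  · abel

theorem mk_io (σ : ZMod (p ^ 2)) (τ z : ZMod p) (v0 : V) (ζ : V →ₗ[ZMod p] ZMod p)
    (A : V →ₗ[ZMod p] V) (a : ZMod p) :
    mk ω σ τ z v0 ζ A (io V a) = io V (red p σ * a) := by
  simp only [mk, io, red_emb]
  rw [mul_comm σ, emb_mul_red, mul_comm a]
  simp [emb_zero]

theorem mk_Bf (halt : ∀ v, ω v v = 0)
    (σ : ZMod (p ^ 2)) (hσ : red p σ ≠ 0) (τ z : ZMod p) (v0 : V) (ζ : V →ₗ[ZMod p] ZMod p)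
    (A : V →ₗ[ZMod p] V) (hA : ∀ v w, ω (A v) (A w) = red p σ * ω v w) (x y) :
    Bf ω (mk ω σ τ z v0 ζ A x) (mk ω σ τ z v0 ζ A y) = red p σ * Bf ω x y := by
  simp only [Bf, mk, map_add, map_mul, red_emb, map_smul, LinearMap.add_apply, LinearMap.smul_apply,
    hA, halt, smul_eq_mul]
  rw [sk halt (A x.2.2) v0]
  field_simp
  ring

theorem mk_inj (halt : ∀ v, ω v v = 0) (hnd : ∀ v, (∀ w, ω v w = 0) → v = 0)
    (σ : (ZMod (p ^ 2))ˣ) (hσ : red p σ ≠ 0) (τ z : ZMod p) (v0 : V)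
    (ζ : V →ₗ[ZMod p] ZMod p)
    (A : V →ₗ[ZMod p] V) (hA : ∀ v w, ω (A v) (A w) = red p σ * ω v w) :
    Function.Injective (mk ω (σ : ZMod (p ^ 2)) τ z v0 ζ A) := by
  have key : ∀ x, mk ω (σ : ZMod (p ^ 2)) τ z v0 ζ A x = 0 → x = 0 := by
    intro x hx
    have hB : ∀ y, Bf ω x y = 0 := by
      intro y
      have := mk_Bf ω halt σ hσ τ z v0 ζ A hA x y
      rw [hx] at this
      have h0 : Bf ω 0 (mk ω (σ : ZMod (p ^ 2)) τ z v0 ζ A y) = 0 := by simp [Bf]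
      rw [h0] at this
      exact (mul_eq_zero.1 this.symm).resolve_left hσ
    obtain ⟨s, t, v⟩ := x
    have ht : t = 0 := by simpa [Bf] using hB (1, 0, 0)
    have hv : v = 0 := hnd v fun w => by simpa [Bf] using hB (0, 0, w)
    subst ht hv
    have h1 : (σ : ZMod (p ^ 2)) * s = 0 := by
      have := congrArg Prod.fst hx
      simpa [mk, emb_zero] using this
    have hs : s = 0 := by simpa using h1
    subst hs
    rfl
  intro x y h
  have : mk ω (σ : ZMod (p ^ 2)) τ z v0 ζ A (x - y) = 0 := by
    have h2 := mk_add ω (σ : ZMod (p ^ 2)) τ z v0 ζ A (x - y) y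
    rw [sub_add_cancel, h] at h2
    exact (right_eq_add.1 h2)
  exact sub_eq_zero.1 (key _ this)

theorem red_unit (σ : (ZMod (p ^ 2))ˣ) : red p σ ≠ 0 := (σ.isUnit.map (red p)).ne_zero

theorem mk_surj [Finite V] (halt : ∀ v, ω v v = 0) (hnd : ∀ v, (∀ w, ω v w = 0) → v = 0)
    (φ : ZMod (p ^ 2) × ZMod p × V → ZMod (p ^ 2) × ZMod p × V)
    (hinj : Function.Injective φ) (hadd : ∀ x y, φ (x + y) = φ x + φ y)
    (hbr : ∀ x y, φ (io V (Bf ω x y)) = io V (Bf ω (φ x) (φ y))) :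
    ∃ (σ : (ZMod (p ^ 2))ˣ) (τ z : ZMod p) (v0 : V) (ζ : V →ₗ[ZMod p] ZMod p)
      (A : V →ₗ[ZMod p] V), (∀ v w, ω (A v) (A w) = red p σ * ω v w) ∧
      φ = mk ω (σ : ZMod (p ^ 2)) τ z v0 ζ A := by
  have : NeZero (p ^ 2) := ⟨pow_ne_zero 2 (Fact.out : p.Prime).ne_zero⟩
  let Φ : ZMod (p ^ 2) × ZMod p × V →+ ZMod (p ^ 2) × ZMod p × V := AddMonoidHom.mk' φ hadd
  have h0 : φ 0 = 0 := Φ.map_zero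
  have hns : ∀ (k : ℕ) x, φ (k • x) = k • φ x := fun k x => map_nsmul Φ k x
  rcases hg : φ (1, 0, 0) with ⟨σ, τ, v0⟩
  have hs : ∀ s : ZMod (p ^ 2), φ (s, 0, 0) = (σ * s, τ * red p s, red p s • v0) := by
    intro s
    have e : (s, (0 : ZMod p), (0 : V)) = s.val • ((1 : ZMod (p ^ 2)), (0 : ZMod p), (0 : V)) := by
      simp
    rw [e, hns, hg]
    have e2 : red p s = (s.val : ZMod p) := by
      conv_lhs => rw [← ZMod.natCast_zmod_val s, map_natCast]
    refine Prod.ext ?_ (Prod.ext ?_ ?_)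
    · simp [mul_comm]
    · simp [e2, mul_comm]
    · simp only [Prod.smul_snd, e2, Nat.cast_smul_eq_nsmul]
  have hio : ∀ a, φ (io V a) = io V (red p σ * a) := by
    intro a
    rw [io, hs, red_emb, mul_comm σ, emb_mul_red]
    simp [io, mul_comm]
  have hσ : red p σ ≠ 0 := by
    intro h
    have h1 := hio 1
    rw [h, zero_mul, io_zero, ← h0] at h1
    have h2 := hinj h1
    rw [← io_zero] at h2
    exact one_ne_zero (io_inj h2)
  have hB : ∀ x y, Bf ω (φ x) (φ y) = red p σ * Bf ω x y := by
    intro x y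
    apply io_inj (V := V)
    rw [← hbr, hio]
  have htor : ∀ (y : ZMod p × V), red p (φ (0, y)).1 = 0 := by
    intro y
    have e : p • ((0 : ZMod (p ^ 2)), y) = 0 := by
      refine Prod.ext (by simp) (Prod.ext (by simp) ?_)
      simp [← Nat.cast_smul_eq_nsmul (ZMod p)]
    have h1 := hns p (0, y)
    rw [e, h0] at h1
    have h2 := congrArg Prod.fst h1
    simp only [Prod.fst_zero, Prod.smul_fst, nsmul_eq_mul] at h2
    rw [p_mul_eq_emb] at h2
    exact emb_eq_zero h2.symm
  -- components on V
  have haddV : ∀ v w : V, φ (0, 0, v + w) = φ (0, 0, v) + φ (0, 0, w) := by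
    intro v w
    rw [← hadd]; simp
  choose ζ' hζ' using fun v : V => exists_emb (htor (0, v))
  let ζ0 : V →+ ZMod p := AddMonoidHom.mk' ζ' (fun v w => emb_inj (by
    rw [emb_add, ← hζ', ← hζ', ← hζ', haddV, Prod.fst_add]))
  let A0 : V →+ V := AddMonoidHom.mk' (fun v => (φ (0, 0, v)).2.2) (fun v w => by
    simp only [haddV, Prod.snd_add])
  let ζ : V →ₗ[ZMod p] ZMod p := ζ0.toZModLinearMap p
  let A : V →ₗ[ZMod p] V := A0.toZModLinearMap p
  have hAv : ∀ v, A v = (φ (0, 0, v)).2.2 := fun v => rfl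
  have hζv : ∀ v, (φ (0, 0, v)).1 = emb p (ζ v) := fun v => hζ' v
  have hA : ∀ v w, ω (A v) (A w) = red p σ * ω v w := by
    intro v w
    have h1 := hB (0, 0, v) (0, 0, w)
    simp only [Bf, htor] at h1
    simpa [hAv] using h1
  have hAinj : Function.Injective A := by
    rw [injective_iff_map_eq_zero]
    intro v hv
    apply hnd
    intro w
    have h1 := hA v w
    rw [hv] at h1
    simpa [hσ] using h1
  have hAsurj : Function.Surjective A := Finite.injective_iff_surjective.1 hAinj
  obtain ⟨z, hz⟩ := exists_emb (htor (1, 0))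
  have hvh : (φ (0, 1, 0)).2.2 = 0 := by
    apply hnd
    intro w
    obtain ⟨v, rfl⟩ := hAsurj w
    have h1 := hB (0, 1, 0) (0, 0, v)
    simp only [Bf, htor] at h1
    simpa [hAv] using h1
  have hth : (φ (0, 1, 0)).2.1 = 1 := by
    have h1 := hB (1, 0, 0) (0, 1, 0)
    simp only [Bf, htor, hvh, hg] at h1
    simpa [hσ] using h1
  have hh : φ (0, 1, 0) = (emb p z, 1, 0) := Prod.ext hz (Prod.ext hth hvh)
  have ht : ∀ t : ZMod p, φ (0, t, 0) = (emb p (z * t), t, 0) := by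
    intro t
    have e : ((0 : ZMod (p ^ 2)), t, (0 : V)) = t.val • ((0 : ZMod (p ^ 2)), (1 : ZMod p), (0 : V)) := by
      simp
    rw [e, hns, hh]
    refine Prod.ext ?_ (Prod.ext ?_ ?_)
    · have := emb_mul_red z (t.val : ZMod (p ^ 2))
      rw [map_natCast, ZMod.natCast_zmod_val] at this
      simp [← this, mul_comm]
    · simp
    · simp
  have hθ : ∀ v, (φ (0, 0, v)).2.1 = - ((red p σ)⁻¹ * ω v0 (A v)) := by
    intro v
    have h1 := hB (1, 0, 0) (0, 0, v)
    simp only [Bf, htor, hg, ← hAv] at h1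
    simp only [map_one, map_zero, LinearMap.zero_apply, mul_zero, zero_mul, sub_zero,
      add_zero] at h1
    field_simp
    linear_combination h1
  refine ⟨(isUnit_of_red hσ).unit, τ, z, v0, ζ, A, hA, ?_⟩
  funext x
  obtain ⟨s, t, v⟩ := x
  have e : (s, t, v) = ((s, 0, 0) + (0, t, 0) + (0, 0, v) : ZMod (p ^ 2) × ZMod p × V) := by simp
  have hv : φ (0, 0, v) = (emb p (ζ v), - ((red p σ)⁻¹ * ω v0 (A v)), A v) :=
    Prod.ext (hζv v) (Prod.ext (hθ v) rfl)
  rw [e, hadd, hadd, hs, ht, hv, ← e]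
  simp only [mk, IsUnit.unit_spec, Prod.mk_add_mk, emb_add]
  refine Prod.ext ?_ (Prod.ext ?_ ?_) <;> simp only
  · ring
  · ring
  · rw [add_zero, add_comm]

theorem card_lie [Finite V] (halt : ∀ v, ω v v = 0) (hnd : ∀ v, (∀ w, ω v w = 0) → v = 0)
    (c : ZMod p) (hc : 2 * c = 1) (N : ℕ) (hN : ∀ l : ZMod p, l ≠ 0 → Nat.card (Sim ω l) = N) :
    Nat.card {φ : ZMod (p ^ 2) × ZMod p × V → ZMod (p ^ 2) × ZMod p × V //
        Function.Injective φ ∧ ∀ x y, φ (bmul ω c x y) = bmul ω c (φ x) (φ y)} =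
      p * (p - 1) * (p * p * Nat.card V * Nat.card (V →ₗ[ZMod p] ZMod p) * N) := by
  have : NeZero (p ^ 2) := ⟨pow_ne_zero 2 (Fact.out : p.Prime).ne_zero⟩
  let F : (Σ σ : (ZMod (p ^ 2))ˣ, ((((ZMod p × ZMod p) × V) × (V →ₗ[ZMod p] ZMod p)) ×
      Sim ω (red p σ))) →
      {φ : ZMod (p ^ 2) × ZMod p × V → ZMod (p ^ 2) × ZMod p × V //
        Function.Injective φ ∧ ∀ x y, φ (bmul ω c x y) = bmul ω c (φ x) (φ y)} :=
    fun P => ⟨mk ω P.1 P.2.1.1.1.1 P.2.1.1.1.2 P.2.1.1.2 P.2.1.2 P.2.2.1,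
      mk_inj ω halt hnd _ (red_unit _) _ _ _ _ _ P.2.2.2, fun x y => by
        rw [bmul, bmul, mk_add, mk_add, mk_io, mk_Bf ω halt _ (red_unit _) _ _ _ _ _ P.2.2.2]
        congr 2
        ring⟩
  have hF : Function.Bijective F := by
    constructor
    · rintro ⟨σ, ⟨⟨⟨τ, z⟩, v0⟩, ζ⟩, ⟨A, hA⟩⟩ ⟨σ', ⟨⟨⟨τ', z'⟩, v0'⟩, ζ'⟩, ⟨A', hA'⟩⟩ h
      have h1 : ∀ x, mk ω σ τ z v0 ζ A x = mk ω σ' τ' z' v0' ζ' A' x :=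
        fun x => congrFun (congrArg Subtype.val h) x
      have hg := h1 (1, 0, 0)
      simp only [mk, map_one, map_zero, mul_zero, mul_one, add_zero, zero_add, emb_zero, sub_zero,
        one_smul, Prod.mk.injEq, Units.val_inj] at hg
      obtain ⟨rfl, rfl, rfl⟩ := hg
      have hh := h1 (0, 1, 0)
      simp only [mk, map_zero, mul_zero, mul_one, add_zero, zero_add, Prod.mk.injEq] at hh
      have hz := emb_inj hh.1
      subst hz
      have hAA : A = A' := by
        ext v
        have := congrArg (fun x => x.2.2) (h1 (0, 0, v))
        simpa [mk] using this
      subst hAA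
      have hζ : ζ = ζ' := by
        ext v
        have := congrArg (fun x => x.1) (h1 (0, 0, v))
        simp only [mk, mul_zero, zero_add] at this
        exact emb_inj this
      subst hζ
      rfl
    · rintro ⟨φ, hinj, hφ⟩
      obtain ⟨hadd, hbr⟩ := lie_of_bmul halt c hc φ hφ
      obtain ⟨σ, τ, z, v0, ζ, A, hA, rfl⟩ := mk_surj ω halt hnd φ hinj hadd hbr
      exact ⟨⟨σ, (((τ, z), v0), ζ), ⟨A, hA⟩⟩, rfl⟩
  have hfin : Finite (V →ₗ[ZMod p] V) := Finite.of_injective _ DFunLike.coe_injective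
  have hfin' : Finite (V →ₗ[ZMod p] ZMod p) := Finite.of_injective _ DFunLike.coe_injective
  have : ∀ l, Finite (Sim ω l) := fun l => by unfold Sim; infer_instance
  rw [← Nat.card_congr (Equiv.ofBijective F hF), Nat.card_sigma]
  have h : ∀ σ : (ZMod (p ^ 2))ˣ, Nat.card ((((ZMod p × ZMod p) × V) × (V →ₗ[ZMod p] ZMod p)) ×
      Sim ω (red p σ)) = p * p * Nat.card V * Nat.card (V →ₗ[ZMod p] ZMod p) * N := fun σ => by
    simp only [Nat.card_prod, hN _ (red_unit σ), Nat.card_zmod]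
  simp only [h, Finset.sum_const, smul_eq_mul, Finset.card_univ, ZMod.card_units_eq_totient]
  rw [Nat.totient_prime_pow (Fact.out : p.Prime) (by norm_num)]
  simp

end Lie
section Std

variable {p : ℕ} [Fact p.Prime]

/-- standard symplectic form -/
def om (p m : ℕ) : ((Fin m → ZMod p) × (Fin m → ZMod p)) →ₗ[ZMod p]
    ((Fin m → ZMod p) × (Fin m → ZMod p)) →ₗ[ZMod p] ZMod p :=
  LinearMap.mk₂ (ZMod p) (fun x y => x.1 ⬝ᵥ y.2 - y.1 ⬝ᵥ x.2)
    (fun x y z => by simp only [Prod.fst_add, Prod.snd_add, add_dotProduct, dotProduct_add]; ring)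
    (fun c x y => by
      simp only [Prod.smul_fst, Prod.smul_snd, smul_dotProduct, dotProduct_smul, smul_eq_mul]; ring)
    (fun x y z => by simp only [Prod.fst_add, Prod.snd_add, add_dotProduct, dotProduct_add]; ring)
    (fun c x y => by
      simp only [Prod.smul_fst, Prod.smul_snd, smul_dotProduct, dotProduct_smul, smul_eq_mul]; ring)

theorem om_apply (m : ℕ) (x y : (Fin m → ZMod p) × (Fin m → ZMod p)) :
    om p m x y = x.1 ⬝ᵥ y.2 - y.1 ⬝ᵥ x.2 := rfl

theorem om_alt (m : ℕ) (v) : om p m v v = 0 := by simp [om_apply]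

theorem om_nd (m : ℕ) (v) (h : ∀ w, om p m v w = 0) : v = 0 := by
  refine Prod.ext (funext fun i => ?_) (funext fun i => ?_)
  · simpa [om_apply] using h (0, Pi.single i 1)
  · simpa [om_apply] using h (Pi.single i 1, 0)

theorem card_sim (m : ℕ) (l : ZMod p) : Nat.card (Sim (om p m) l) = Nat.card (Symp (om p m) m l) := by
  let F : Sim (om p m) l → Symp (om p m) m l := fun A =>
    ⟨(fun i => A.1 (Pi.single i 1, 0), fun i => A.1 (0, Pi.single i 1)),
      fun i j => by rw [A.2]; simp [om_apply],
      fun i j => by rw [A.2]; simp [om_apply],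
      fun i j => by rw [A.2]; simp [om_apply, Pi.single_apply, eq_comm]⟩
  apply Nat.card_congr (Equiv.ofBijective F _)
  constructor
  · rintro ⟨A, hA⟩ ⟨A', hA'⟩ h
    have h := congrArg Subtype.val h
    apply Subtype.ext
    simp only
    have h1 := fun i => congrFun (congrArg Prod.fst h) i
    have h2 := fun i => congrFun (congrArg Prod.snd h) i
    simp only [F] at h1 h2
    refine LinearMap.prod_ext ?_ ?_
    · refine LinearMap.pi_ext' fun i => LinearMap.ext_ring ?_
      exact h1 i
    · refine LinearMap.pi_ext' fun i => LinearMap.ext_ring ?_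
      exact h2 i
  · rintro ⟨⟨a, b⟩, h1, h2, h3⟩
    simp only at h1 h2 h3
    let A : ((Fin m → ZMod p) × (Fin m → ZMod p)) →ₗ[ZMod p]
        ((Fin m → ZMod p) × (Fin m → ZMod p)) :=
      LinearMap.coprod (Fintype.linearCombination (ZMod p) a) (Fintype.linearCombination (ZMod p) b)
    have hAv : ∀ v, A v = ∑ i, v.1 i • a i + ∑ i, v.2 i • b i := fun v => by
      simp [A, Fintype.linearCombination_apply]
    have h4 : ∀ i j, om p m (b i) (a j) = if i = j then -l else 0 := fun i j => by
      rw [sk (om_alt m), h3]; simp only [eq_comm]; split_ifs <;> simp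
    refine ⟨⟨A, fun v w => ?_⟩, ?_⟩
    · rw [hAv, hAv]
      simp only [map_add, map_sum, map_smul, LinearMap.add_apply, LinearMap.sum_apply,
        LinearMap.smul_apply, h1, h2, h3, h4, smul_eq_mul]
      simp only [om_apply, dotProduct, mul_sub, Finset.mul_sum]
      simp [sub_eq_add_neg, add_comm, ← Finset.sum_neg_distrib]
      congr 1 <;> refine Finset.sum_congr rfl fun i _ => by ring
    · apply Subtype.ext
      refine Prod.ext (funext fun i => ?_) (funext fun i => ?_)
      · simp [F, A]
      · simp [F, A]

/-- Baer coordinates -/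
def baer (p m : ℕ) [Fact p.Prime] (c : ZMod p) : ES2 p m ≃
    ZMod (p ^ 2) × ZMod p × ((Fin m → ZMod p) × (Fin m → ZMod p)) where
  toFun x := (x.u1 - emb p (c * (x.w1 * red p x.u1 + x.u ⬝ᵥ x.w)), x.w1, (x.u, x.w))
  invFun y := ⟨y.1 + emb p (c * (y.2.1 * red p y.1 + y.2.2.1 ⬝ᵥ y.2.2.2)), y.2.2.1, y.2.1, y.2.2.2⟩
  left_inv x := by
    ext <;> simp [red_emb]
  right_inv y := by
    simp [red_emb]

theorem baer_mul (m : ℕ) (c : ZMod p) (hc : 2 * c = 1) (x y : ES2 p m) :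
    baer p m c (x * y) = bmul (om p m) c (baer p m c x) (baer p m c y) := by
  simp only [baer, bmul, Equiv.coe_fn_mk, Bf, io, ES2.mul_u1, ES2.mul_u, ES2.mul_w, ES2.mul_w1]
  refine Prod.ext ?_ (Prod.ext ?_ (Prod.ext ?_ ?_)) <;> simp only [Prod.mk_add_mk, Prod.snd_add,
    Prod.fst_add, add_zero]
  simp only [map_add, map_sub, map_mul, red_emb, om_apply, emb_mul_red, zero_mul, add_zero,
    sub_zero, add_dotProduct, dotProduct_add]
  rw [sub_eq_add_neg, sub_eq_add_neg, sub_eq_add_neg, ← emb_neg, ← emb_neg, ← emb_neg]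
  have key : ∀ (s t : ZMod (p ^ 2)) (a b d f g h : ZMod p), a + b + d = f + g + h →
      s + t + emb p a + emb p b + emb p d = s + emb p f + (t + emb p g) + emb p h := by
    intro s t a b d f g h hh
    have := congrArg (emb p) hh
    simp only [emb_add] at this
    linear_combination this
  apply key
  linear_combination (-(y.w1 * red p x.u1 + x.u ⬝ᵥ y.w)) * hc

end Std

theorem ES2_card_aut (p m : ℕ) [Fact p.Prime] (hodd : Odd p) :
    Nat.card (ES2 p m ≃* ES2 p m)
      = p ^ ((m + 1) ^ 2 + 2 * (m + 1)) * (p - 1)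
          * ∏ j ∈ Finset.Icc 1 m, (p ^ (2 * j) - 1) := by
  have : NeZero (p ^ 2) := ⟨pow_ne_zero 2 (Fact.out : p.Prime).ne_zero⟩
  obtain ⟨c, hc⟩ : ∃ c : ZMod p, 2 * c = 1 := by
    obtain ⟨k, hk⟩ := hodd
    refine ⟨k + 1, ?_⟩
    have : ((2 * k + 1 : ℕ) : ZMod p) = 0 := by rw [← hk]; simp
    push_cast at this
    linear_combination this
  let e := baer p m c
  have E : (ES2 p m ≃* ES2 p m) ≃ {φ : ZMod (p ^ 2) × ZMod p × ((Fin m → ZMod p) × (Fin m → ZMod p))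
        → ZMod (p ^ 2) × ZMod p × ((Fin m → ZMod p) × (Fin m → ZMod p)) //
        Function.Injective φ ∧ ∀ x y, φ (bmul (om p m) c x y) = bmul (om p m) c (φ x) (φ y)} := by
    refine Equiv.ofBijective (fun f => ⟨fun x => e (f (e.symm x)), ?_, ?_⟩) ⟨?_, ?_⟩
    · exact e.injective.comp (f.injective.comp e.symm.injective)
    · intro x y
      obtain ⟨x, rfl⟩ := e.surjective x
      obtain ⟨y, rfl⟩ := e.surjective y
      rw [← baer_mul m c hc]
      change e (f (e.symm (e (x * y)))) = _
      simp only [Equiv.symm_apply_apply, map_mul]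
      exact baer_mul m c hc _ _
    · intro f g h
      ext1 x
      have := congrFun (congrArg Subtype.val h) (e x)
      simpa using this
    · rintro ⟨φ, hi, hm⟩
      have hb : Function.Bijective φ := Finite.injective_iff_bijective.1 hi
      refine ⟨MulEquiv.mk' (e.trans ((Equiv.ofBijective φ hb).trans e.symm)) ?_, ?_⟩
      · intro x y
        apply e.injective
        have h2 := baer_mul m c hc (e.symm (φ (e x))) (e.symm (φ (e y)))
        change e _ = bmul (om p m) c (e (e.symm (φ (e x)))) (e (e.symm (φ (e y)))) at h2
        rw [Equiv.apply_symm_apply, Equiv.apply_symm_apply, ← hm] at h2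
        simp only [Equiv.trans_apply, Equiv.ofBijective_apply, Equiv.apply_symm_apply]
        rw [h2]
        exact congrArg φ (baer_mul m c hc x y)
      · apply Subtype.ext
        funext x
        simp [MulEquiv.mk']
  have hV : Nat.card ((Fin m → ZMod p) × (Fin m → ZMod p)) = p ^ (2 * m) := by
    simp [Nat.card_prod, Nat.card_pi, two_mul, pow_add]
  have hD : Nat.card (((Fin m → ZMod p) × (Fin m → ZMod p)) →ₗ[ZMod p] ZMod p) = p ^ (2 * m) := by
    rw [Module.natCard_eq_pow_finrank (K := ZMod p)]
    change _ ^ Module.finrank (ZMod p) (Module.Dual (ZMod p) _) = _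
    rw [Subspace.dual_finrank_eq]
    simp [two_mul]
  rw [Nat.card_congr E, card_lie (om p m) (om_alt m) (om_nd m) c hc _ (fun l hl => by
    rw [card_sim, card_symp m _ (om p m) (om_alt m) (om_nd m) l hl hV]), hV, hD]
  ring
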